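/- Let G be the 10 × 10 real symmetric matrix with all diagonal entries equal to 1 and off-diagonal entries (symmetrically extended) G₁₂ = −1, G₁₃ = −√22/4, G₂₄ = −√22/4, G₃₅ = −1/2, G₅₆ = −1/2, G₆₈ = −1/2, G₈,₁₀ = −1/2, G₄,₁₀ = −1/2, G₆₇ = −1/2, G₈₉ = −1/2, and all other off-diagonal entries 0. Then G has exactly 7 positive eigenvalues (with multiplicity), exactly 1 negative eigenvalue, and exactly 2 zero eigenvalues; equivalently G has rank 8 and signature (7,1). -/

import Mathlib

open Real

noncomputable def G13 : Matrix (Fin 10) (Fin 10) ℝ :=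
  !![1, -1, -(Real.sqrt 22 / 4), 0, 0, 0, 0, 0, 0, 0;
     -1, 1, 0, -(Real.sqrt 22 / 4), 0, 0, 0, 0, 0, 0;
     -(Real.sqrt 22 / 4), 0, 1, 0, -(1/2), 0, 0, 0, 0, 0;
     0, -(Real.sqrt 22 / 4), 0, 1, 0, 0, 0, 0, 0, -(1/2);
     0, 0, -(1/2), 0, 1, -(1/2), 0, 0, 0, 0;
     0, 0, 0, 0, -(1/2), 1, -(1/2), -(1/2), 0, 0;
     0, 0, 0, 0, 0, -(1/2), 1, 0, 0, 0;
     0, 0, 0, 0, 0, -(1/2), 0, 1, -(1/2), -(1/2);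
     0, 0, 0, 0, 0, 0, 0, -(1/2), 1, 0;
     0, 0, 0, -(1/2), 0, 0, 0, -(1/2), 0, 1]

open Matrix in
/-- The quadratic form of a real symmetric matrix is equivalent to the sum of squares weighted by
its eigenvalues. -/
theorem Matrix.IsHermitian.equivalent_weightedSumSquares_eigenvalues {n : Type*} [Fintype n]
    [DecidableEq n] {A : Matrix n n ℝ} (hA : A.IsHermitian) :
    QuadraticMap.Equivalent A.toQuadraticForm'
      (QuadraticMap.weightedSumSquares ℝ hA.eigenvalues) := by
  let U : Matrix n n ℝ := (hA.eigenvectorUnitary).1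
  have hUU : U * Uᵀ = 1 := Unitary.coe_mul_star_self hA.eigenvectorUnitary
  have hUU' : Uᵀ * U = 1 := Unitary.coe_star_mul_self hA.eigenvectorUnitary
  have hspec : A = U * diagonal hA.eigenvalues * Uᵀ := by
    conv_lhs => rw [hA.spectral_theorem, Unitary.conjStarAlgAut_apply]
    rfl
  refine ⟨⟨Matrix.toLin'OfInv hUU hUU', fun x => ?_⟩⟩
  have key : x ⬝ᵥ A *ᵥ x = (Uᵀ *ᵥ x) ⬝ᵥ diagonal hA.eigenvalues *ᵥ (Uᵀ *ᵥ x) := by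
    conv_lhs => rw [hspec]
    rw [← mulVec_mulVec, ← mulVec_mulVec, dotProduct_mulVec, ← mulVec_transpose]
  change (QuadraticMap.weightedSumSquares ℝ hA.eigenvalues) (Uᵀ *ᵥ x) = A.toQuadraticForm' x
  refine Eq.trans ?_ (Matrix.toLinearMap₂'_apply' A x x).symm
  rw [QuadraticMap.weightedSumSquares_apply, key]
  simp only [dotProduct, mulVec_diagonal, smul_eq_mul]
  exact Finset.sum_congr rfl fun i _ => by ring

open Matrix in
/-- **Sylvester's law of inertia**: if the quadratic form of a real symmetric matrix becomes a
weighted sum of squares after a linear change of coordinates, then the eigenvalues have as many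
positive and as many negative members as the weights. -/
theorem Matrix.IsHermitian.card_eigenvalues_of_dotProduct_eq_sum {n : Type*} [Fintype n]
    [DecidableEq n] {A : Matrix n n ℝ} (hA : A.IsHermitian) (w : n → ℝ)
    (e : (n → ℝ) ≃ₗ[ℝ] (n → ℝ)) (he : ∀ x, ∑ i, w i * (e x i * e x i) = x ⬝ᵥ A *ᵥ x) :
    (Finset.univ.filter fun j => 0 < hA.eigenvalues j).card =
      (Finset.univ.filter fun j => 0 < w j).card ∧
    (Finset.univ.filter fun j => hA.eigenvalues j < 0).card =
      (Finset.univ.filter fun j => w j < 0).card := by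
  have hw : QuadraticMap.Equivalent A.toQuadraticForm' (QuadraticMap.weightedSumSquares ℝ w) := by
    refine ⟨⟨e, fun x => ?_⟩⟩
    change QuadraticMap.weightedSumSquares ℝ w (e x) = _
    rw [QuadraticMap.weightedSumSquares_apply]
    exact (he x).trans (Matrix.toLinearMap₂'_apply' A x x).symm
  have hl := hA.equivalent_weightedSumSquares_eigenvalues
  have hpos := (QuadraticForm.sigPos_of_equiv_weightedSumSquares hl).symm.trans
    (QuadraticForm.sigPos_of_equiv_weightedSumSquares hw)
  have hneg := (QuadraticForm.sigNeg_of_equiv_weightedSumSquares hl).symm.trans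
    (QuadraticForm.sigNeg_of_equiv_weightedSumSquares hw)
  simp only [← Set.ncard_coe_finset, Finset.coe_filter, Finset.mem_univ, true_and]
  exact ⟨hpos, hneg⟩

/-- Linear forms diagonalizing `G13`. The diagram has a reflection symmetry exchanging its two
halves; the first four and the ninth form are symmetric, the others antisymmetric. -/
noncomputable def G13Forms : (Fin 10 → ℝ) →ₗ[ℝ] (Fin 10 → ℝ) where
  toFun x :=
    ![(x 6 + x 8) - (x 5 + x 7) / 2,
      (x 5 + x 7) - 2 * (x 4 + x 9),
      (x 2 + x 3) - (x 4 + x 9) / 2 - √22 / 4 * (x 0 + x 1),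
      (x 4 + x 9) + √22 / 2 * (x 0 + x 1),
      (x 6 - x 8) - (x 5 - x 7) / 2,
      (x 5 - x 7) - 2 / 5 * (x 4 - x 9),
      (x 4 - x 9) - 5 / 8 * (x 2 - x 3),
      (x 2 - x 3) - 4 * √22 / 11 * (x 0 - x 1),
      x 0 + x 1,
      x 0 - x 1]
  map_add' x y := by
    ext i
    fin_cases i <;> simp <;> ring
  map_smul' c x := by
    ext i
    fin_cases i <;> simp <;> ring

theorem G13Forms_injective : Function.Injective G13Forms := by
  rw [← LinearMap.ker_eq_bot, LinearMap.ker_eq_bot']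
  intro x hx
  have h (i : Fin 10) : G13Forms x i = 0 := congrFun hx i
  simp only [G13Forms, LinearMap.coe_mk, AddHom.coe_mk] at h
  have hs : x 0 + x 1 = 0 := h 8
  have hd : x 0 - x 1 = 0 := h 9
  have h0 := h 0
  have h1 := h 1
  have h2 := h 2
  have h3 := h 3
  have h4 := h 4
  have h5 := h 5
  have h6 := h 6
  have h7 := h 7
  simp [hs, hd] at h0 h1 h2 h3 h4 h5 h6 h7
  ext i
  fin_cases i <;> simp <;> linarith

/-- The coefficients of the squares of `G13Forms` in the quadratic form of `G13`. -/
noncomputable def G13Weights : Fin 10 → ℝ :=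
  ![1 / 2, 1 / 8, 1 / 2, -(1 / 8), 1 / 2, 5 / 8, 2 / 5, 11 / 32, 0, 0]

open Matrix in
theorem sum_G13Weights_mul_G13Forms (x : Fin 10 → ℝ) :
    ∑ i, G13Weights i * (G13Forms x i * G13Forms x i) = x ⬝ᵥ G13 *ᵥ x := by
  have h22 : √22 ^ 2 = (22 : ℝ) := Real.sq_sqrt (by norm_num)
  simp [G13Weights, G13Forms, G13, dotProduct, mulVec, Fin.sum_univ_succ]
  ring_nf
  simp only [h22]
  ring

theorem stmt_13 (hG : G13.IsHermitian) :
    (Finset.univ.filter fun j => 0 < hG.eigenvalues j).card = 7 ∧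
    (Finset.univ.filter fun j => hG.eigenvalues j < 0).card = 1 ∧
    (Finset.univ.filter fun j => hG.eigenvalues j = 0).card = 2 ∧
    G13.rank = 8 := by
  obtain ⟨hpos, hneg⟩ := hG.card_eigenvalues_of_dotProduct_eq_sum G13Weights
    (LinearEquiv.ofInjectiveEndo G13Forms G13Forms_injective) sum_G13Weights_mul_G13Forms
  have hwpos : (Finset.univ.filter fun j => 0 < G13Weights j).card = 7 := by
    norm_num [Finset.card_filter, -Finset.sum_boole, Fin.sum_univ_succ, G13Weights]
  have hwneg : (Finset.univ.filter fun j => G13Weights j < 0).card = 1 := by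
    norm_num [Finset.card_filter, -Finset.sum_boole, Fin.sum_univ_succ, G13Weights]
  rw [hwpos] at hpos
  rw [hwneg] at hneg
  have hne : (Finset.univ.filter fun j => hG.eigenvalues j ≠ 0).card = 8 := by
    have hsplit : (Finset.univ.filter fun j => hG.eigenvalues j ≠ 0) =
        (Finset.univ.filter fun j => 0 < hG.eigenvalues j) ∪
          (Finset.univ.filter fun j => hG.eigenvalues j < 0) := by
      ext j
      simp only [Finset.mem_filter, Finset.mem_univ, true_and, Finset.mem_union]
      exact ne_iff_lt_or_gt.trans or_comm
    rw [hsplit, Finset.card_union_of_disjoint, hpos, hneg]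
    exact Finset.disjoint_filter.2 fun j _ hj => hj.le.not_gt
  have hzero := Finset.card_filter_add_card_filter_not (s := Finset.univ)
    (fun j => hG.eigenvalues j = 0)
  rw [Finset.card_univ, Fintype.card_fin, hne] at hzero
  refine ⟨hpos, hneg, by omega, ?_⟩
  rw [hG.rank_eq_card_non_zero_eigs, Fintype.card_subtype, hne]
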